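/- Let d ∈ N, s > 0 and 0 < r < ∞. Then lim_{n→∞} [ n^{s} · a_n(I_d : H^{s,r}_mix(T^d) → L₂(T^d)) / (ln n)^{(d−1)s} ] = (2^d/(d−1)!)^{s}, where I_d denotes the embedding of H^{s,r}_mix(T^d) into L₂(T^d). -/

import Mathlib

open MeasureTheory Filter
open scoped ENNReal NNReal

noncomputable section

/-- The index lattice `ℤ^d`. -/
abbrev ZLat (d : ℕ) := Fin d → ℤ

instance fact_two_pi_pos : Fact (0 < 2 * Real.pi) := ⟨by positivity⟩

/-- The `d`-dimensional torus `𝕋^d = [0,2π]^d` with endpoints identified. -/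
abbrev Torus (d : ℕ) := Fin d → AddCircle (2 * Real.pi)

/-- The normalized Lebesgue measure `(2π)^{-d} dx` on the `d`-torus. -/
def torusMeasure (d : ℕ) : Measure (Torus d) :=
  ((ENNReal.ofReal (2 * Real.pi))⁻¹) ^ d • Measure.pi fun _ => volume

/-- The character `e^{i k·x}` on the `d`-torus. -/
def torusChar {d : ℕ} (k : ZLat d) (x : Torus d) : ℂ :=
  ∏ j, fourier (k j) (x j)

/-- The `k`-th Fourier coefficient `f̂(k) = (2π)^{-d} ∫_{𝕋^d} f(x) e^{-i k·x} dx`. -/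
def fourierCoef {d : ℕ} (f : Torus d → ℂ) (k : ZLat d) : ℂ :=
  ∫ x, (starRingEnd ℂ) (torusChar k x) * f x ∂(torusMeasure d)

/-- The `n`-th approximation number of a bounded linear operator `T`:
`a_n(T) = inf {‖T - A‖ : rank A < n}`. -/
def approxNum {X Y : Type*} [NormedAddCommGroup X] [NormedSpace ℂ X]
    [NormedAddCommGroup Y] [NormedSpace ℂ Y] (T : X →L[ℂ] Y) (n : ℕ) : ℝ :=
  sInf {c : ℝ | ∃ A : X →L[ℂ] Y,
    Module.rank ℂ (LinearMap.range (A : X →ₗ[ℂ] Y)) < n ∧ c = ‖T - A‖}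

/-- `ℓ²(ℤ^d)`; an isometric model of the Hilbert space `F_d(w)` via `f ↦ (w(k)·f̂(k))_k`.
Under this identification the embedding `I_d : F_d(w) → G` is characterized by the
property that the function `T c` has Fourier coefficients `c(k)/w(k)`. -/
abbrev ellTwo (d : ℕ) := lp (fun _ : ZLat d => ℂ) 2

/-- `ℓ¹(ℤ^d)`; an isometric model of the Wiener algebra `A(𝕋^d)` via `f ↦ (f̂(k))_k`. -/
abbrev ellOne (d : ℕ) := lp (fun _ : ZLat d => ℂ) 1

/-- `ℓ^∞(ℤ^d)`; an isometric model of the space `ℬ(𝕋^d)` of distributions with bounded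
Fourier coefficients. -/
abbrev ellInfty (d : ℕ) := lp (fun _ : ZLat d => ℂ) ⊤

/-- The weight `w^{mix}_{s,r}(k) = ∏_j (1+|k_j|^r)^{s/r}` of the Sobolev space of
dominating mixed smoothness `H^{s,r}_mix(𝕋^d) = F_d(w^{mix}_{s,r})`. -/
def wMix (d : ℕ) (s r : ℝ) (k : ZLat d) : ℝ := ∏ j, (1 + |(k j : ℝ)| ^ r) ^ (s / r)


section Fourier

open AddCircle

theorem torusMeasure_eq_pi_haar (d : ℕ) :
    torusMeasure d =
      Measure.pi fun _ : Fin d => (haarAddCircle : Measure (AddCircle (2 * Real.pi))) := by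
  refine (Measure.pi_eq fun t _ => ?_).symm
  have h0 : ENNReal.ofReal (2 * Real.pi) ≠ 0 := by
    simpa using Real.pi_pos
  simp only [torusMeasure, Measure.smul_apply, smul_eq_mul, Measure.pi_pi]
  simp only [volume_eq_smul_haarAddCircle, Measure.smul_apply, smul_eq_mul,
    Finset.prod_mul_distrib, Finset.prod_const, Finset.card_univ, Fintype.card_fin]
  rw [← mul_assoc, ← mul_pow, ENNReal.inv_mul_cancel h0 ENNReal.ofReal_ne_top, one_pow, one_mul]

instance isProbabilityMeasure_torusMeasure (d : ℕ) : IsProbabilityMeasure (torusMeasure d) := by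
  rw [torusMeasure_eq_pi_haar]
  infer_instance

variable {d : ℕ}

/-- The character `torusChar k` as a continuous function. -/
def torusCharC (k : ZLat d) : C(Torus d, ℂ) where
  toFun x := torusChar k x
  continuous_toFun := by
    unfold torusChar
    fun_prop

theorem torusChar_neg (k : ZLat d) (x : Torus d) :
    torusChar (-k) x = (starRingEnd ℂ) (torusChar k x) := by
  simp only [torusChar, Pi.neg_apply, fourier_neg, map_prod]

theorem torusChar_add (k l : ZLat d) (x : Torus d) :
    torusChar (k + l) x = torusChar k x * torusChar l x := by
  simp only [torusChar, Pi.add_apply, fourier_add, ← Finset.prod_mul_distrib]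

theorem torusChar_zero (x : Torus d) : torusChar 0 x = 1 := by
  simp [torusChar]

theorem torusChar_single (i : Fin d) (x : Torus d) :
    torusChar (Pi.single i 1) x = toCircle (x i) := by
  rw [torusChar, Finset.prod_eq_single i]
  · simp [fourier_apply]
  · intro j _ hj
    simp [Pi.single_eq_of_ne hj]
  · simp

theorem span_torusCharC_closure_eq_top :
    (Submodule.span ℂ (Set.range (torusCharC (d := d)))).topologicalClosure = ⊤ := by
  let A : StarSubalgebra ℂ C(Torus d, ℂ) :=
    { toSubalgebra := Algebra.adjoin ℂ (Set.range torusCharC)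
      star_mem' := by
        change Algebra.adjoin ℂ (Set.range torusCharC) ≤
          star (Algebra.adjoin ℂ (Set.range torusCharC))
        refine Algebra.adjoin_le ?_
        rintro _ ⟨k, rfl⟩
        refine Algebra.subset_adjoin ⟨-k, ?_⟩
        ext1 x
        exact torusChar_neg k x }
  have hA : A.toSubalgebra.toSubmodule = Submodule.span ℂ (Set.range torusCharC) := by
    apply Algebra.adjoin_eq_span_of_subset
    refine .trans (fun x ↦ Submonoid.closure_induction (fun _ ↦ id) ⟨0, ?_⟩ ?_)
      Submodule.subset_span
    · ext x
      exact torusChar_zero x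
    · rintro _ _ _ _ ⟨k, rfl⟩ ⟨l, rfl⟩
      refine ⟨k + l, ?_⟩
      ext x
      exact torusChar_add k l x
  have hsep : A.SeparatesPoints := by
    intro x y hxy
    obtain ⟨i, hi⟩ := Function.ne_iff.mp hxy
    refine ⟨_, ⟨torusCharC (Pi.single i 1), Algebra.subset_adjoin ⟨Pi.single i 1, rfl⟩, rfl⟩, ?_⟩
    change torusChar _ x ≠ torusChar _ y
    rw [torusChar_single, torusChar_single]
    exact fun h => hi (AddCircle.injective_toCircle Real.two_pi_pos.ne' (Subtype.ext h))
  rw [← hA]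
  exact congr_arg (Subalgebra.toSubmodule <| StarSubalgebra.toSubalgebra ·)
    (ContinuousMap.starSubalgebra_topologicalClosure_eq_top_of_separatesPoints A hsep)

/-- The character `torusChar k` as an element of `L²`. -/
def torusCharLp (k : ZLat d) : Lp ℂ 2 (torusMeasure d) :=
  ContinuousMap.toLp (E := ℂ) 2 (torusMeasure d) ℂ (torusCharC k)

theorem span_torusCharLp_closure_eq_top :
    (Submodule.span ℂ (Set.range (torusCharLp (d := d)))).topologicalClosure = ⊤ := by
  have h := (ContinuousMap.toLp_denseRange ℂ (torusMeasure d) ℂ (p := 2)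
    ENNReal.ofNat_ne_top).topologicalClosure_map_submodule span_torusCharC_closure_eq_top
  rw [Submodule.map_span, ← Set.range_comp] at h
  exact h

theorem integral_torusChar (k : ZLat d) :
    ∫ x, torusChar k x ∂(torusMeasure d) = if k = 0 then 1 else 0 := by
  split_ifs with h
  · simp [h, torusChar_zero]
  · obtain ⟨i, hi⟩ := Function.ne_iff.mp h
    rw [torusMeasure_eq_pi_haar]
    unfold torusChar
    rw [MeasureTheory.integral_fintype_prod_eq_prod]
    apply Finset.prod_eq_zero (Finset.mem_univ i)
    have := fourierCoeff_fourier (T := 2 * Real.pi) (k i)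
    have := congr_fun this 0
    rw [Pi.single_eq_of_ne (show (0 : ℤ) ≠ k i from Ne.symm hi)] at this
    simpa [fourierCoeff] using this

theorem orthonormal_torusCharLp : Orthonormal ℂ (torusCharLp (d := d)) := by
  rw [orthonormal_iff_ite]
  intro k l
  simp only [torusCharLp, ContinuousMap.inner_toLp]
  have : ∀ x, torusCharC l x * (starRingEnd ℂ) (torusCharC k x) = torusChar (l - k) x := by
    intro x
    rw [sub_eq_add_neg, torusChar_add, torusChar_neg]
    rfl
  simp only [this, integral_torusChar, sub_eq_zero, eq_comm]

/-- The Hilbert basis of characters of `L²(𝕋^d)`. -/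
def torusBasis (d : ℕ) : HilbertBasis (ZLat d) ℂ (Lp ℂ 2 (torusMeasure d)) :=
  HilbertBasis.mk orthonormal_torusCharLp span_torusCharLp_closure_eq_top.ge

theorem torusBasis_repr (f : Lp ℂ 2 (torusMeasure d)) (k : ZLat d) :
    (torusBasis d).repr f k = fourierCoef f k := by
  rw [HilbertBasis.repr_apply_apply, torusBasis, HilbertBasis.coe_mk, L2.inner_def, fourierCoef]
  refine integral_congr_ae ?_
  filter_upwards [ContinuousMap.coeFn_toLp (p := 2) (𝕜 := ℂ) (torusMeasure d) (torusCharC k)]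
    with x hx
  rw [RCLike.inner_apply, mul_comm]
  congr 2

end Fourier

section ApproximationNumbers

variable {ι H : Type} [NormedAddCommGroup H] [InnerProductSpace ℂ H]

theorem approxNum_le_of_rank_lt {X Y : Type*} [NormedAddCommGroup X] [NormedSpace ℂ X]
    [NormedAddCommGroup Y] [NormedSpace ℂ Y] (T A : X →L[ℂ] Y) {n : ℕ}
    (hA : Module.rank ℂ (LinearMap.range (A : X →ₗ[ℂ] Y)) < n) : approxNum T n ≤ ‖T - A‖ :=
  csInf_le ⟨0, by rintro _ ⟨B, -, rfl⟩; exact norm_nonneg _⟩ ⟨A, hA, rfl⟩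

/-- The approximation numbers of a diagonal operator are bounded above by any bound of the
diagonal off a set of fewer than `n` indices. -/
theorem approxNum_le_of_diagonal (b : HilbertBasis ι ℂ H) (T : lp (fun _ : ι => ℂ) 2 →L[ℂ] H)
    (σ : ι → ℂ) (hT : ∀ c k, b.repr (T c) k = σ k * c k) {n : ℕ} {ε : ℝ} (hε : 0 ≤ ε)
    (S : Finset ι) (hS : S.card < n) (h : ∀ k ∉ S, ‖σ k‖ ≤ ε) : approxNum T n ≤ ε := by
  classical
  let A : lp (fun _ : ι => ℂ) 2 →L[ℂ] H :=
    ∑ k ∈ S, (lp.evalCLM ℂ (fun _ : ι => ℂ) 2 k).smulRight (σ k • b k)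
  have hAapp : ∀ c, A c = ∑ k ∈ S, c k • σ k • b k := by
    intro c
    simp only [A, sum_apply, ContinuousLinearMap.smulRight_apply]
    rfl
  have hA : Module.rank ℂ (LinearMap.range (A : lp (fun _ : ι => ℂ) 2 →ₗ[ℂ] H)) < n := by
    have hle : LinearMap.range (A : lp (fun _ : ι => ℂ) 2 →ₗ[ℂ] H) ≤
        Submodule.span ℂ ((S.image b : Finset H) : Set H) := by
      rintro _ ⟨c, rfl⟩
      rw [ContinuousLinearMap.coe_coe, hAapp]
      refine Submodule.sum_mem _ fun k hk => Submodule.smul_mem _ _ (Submodule.smul_mem _ _ ?_)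
      exact Submodule.subset_span (by simpa using ⟨k, hk, rfl⟩)
    refine (Submodule.rank_mono hle).trans_lt ((rank_span_finset_le _).trans_lt ?_)
    exact_mod_cast Finset.card_image_le.trans_lt hS
  refine (approxNum_le_of_rank_lt T A hA).trans ?_
  refine ContinuousLinearMap.opNorm_le_bound _ hε fun c => ?_
  rw [← b.repr.norm_map, show ε * ‖c‖ = ‖(ε : ℂ) • c‖ by
    rw [norm_smul, Complex.norm_real, Real.norm_of_nonneg hε]]
  refine lp.norm_mono two_ne_zero fun k => ?_
  have hk : b.repr ((T - A) c) k = if k ∈ S then 0 else σ k * c k := by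
    rw [sub_apply, map_sub, lp.coeFn_sub, Pi.sub_apply, hT, hAapp, map_sum,
      lp.coeFn_sum, Finset.sum_apply]
    simp only [map_smul, HilbertBasis.repr_self, lp.coeFn_smul, Pi.smul_apply, lp.single_apply,
      Pi.single_apply, smul_eq_mul, mul_ite, mul_one, mul_zero, Finset.sum_ite_eq]
    split_ifs <;> ring
  rw [hk, lp.coeFn_smul, Pi.smul_apply, smul_eq_mul, norm_mul, Complex.norm_real,
    Real.norm_of_nonneg hε]
  split_ifs with hkS
  · rw [norm_zero]; positivity
  · rw [norm_mul]
    gcongr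
    exact h k hkS

/-- The approximation numbers of a diagonal operator are bounded below by any lower bound of the
diagonal on a set of at least `n` indices. -/
theorem le_approxNum_of_diagonal (b : HilbertBasis ι ℂ H) (T : lp (fun _ : ι => ℂ) 2 →L[ℂ] H)
    (σ : ι → ℂ) (hT : ∀ c k, b.repr (T c) k = σ k * c k) {n : ℕ} (hn : 0 < n) {ε : ℝ}
    (hε : 0 ≤ ε) (S : Finset ι) (hS : n ≤ S.card) (h : ∀ k ∈ S, ε ≤ ‖σ k‖) :
    ε ≤ approxNum T n := by
  classical
  refine le_csInf ⟨_, 0, by simpa using hn, rfl⟩ ?_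
  rintro _ ⟨A, hA, rfl⟩
  let E : (S → ℂ) →ₗ[ℂ] lp (fun _ : ι => ℂ) 2 :=
    ∑ k : S, (lp.lsingle (𝕜 := ℂ) (E := fun _ : ι => ℂ) 2 (k : ι)).comp (LinearMap.proj k)
  have hE : ∀ (x : S → ℂ) (k : ι), E x k = if hk : k ∈ S then x ⟨k, hk⟩ else 0 := by
    intro x k
    simp only [E, LinearMap.sum_apply, LinearMap.comp_apply, LinearMap.proj_apply, lp.coeFn_sum,
      Finset.sum_apply]
    have : ∀ j : S, (lp.lsingle (𝕜 := ℂ) (E := fun _ : ι => ℂ) 2 (j : ι) (x j)) k =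
        if (j : ι) = k then x j else 0 := by
      intro j
      change (lp.single (E := fun _ : ι => ℂ) 2 (j : ι) (x j)) k = _
      rw [lp.single_apply, Pi.single_apply]
      simp only [eq_comm]
    simp only [this]
    split_ifs with hk
    · rw [Finset.sum_eq_single ⟨k, hk⟩] <;> grind
    · exact Finset.sum_eq_zero fun j _ => if_neg (by rintro rfl; exact hk j.2)
  obtain ⟨x, hx0, hx⟩ : ∃ x : S → ℂ, x ≠ 0 ∧ A (E x) = 0 := by
    by_contra! hcon
    have hinj : Function.Injective
        ((A : lp (fun _ : ι => ℂ) 2 →ₗ[ℂ] H).rangeRestrict.comp E) := by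
      rw [injective_iff_map_eq_zero]
      intro x hx
      by_contra hx0
      exact hcon x hx0 (congrArg Subtype.val hx)
    have := LinearMap.rank_le_of_injective _ hinj
    rw [rank_fun', Fintype.card_coe] at this
    exact absurd (this.trans_lt hA) (by exact_mod_cast hS.not_gt)
  have hEx : E x ≠ 0 := by
    intro h0
    refine hx0 (funext fun k => ?_)
    have := hE x k
    rw [h0, dif_pos k.2] at this
    exact this.symm
  have hlow : ε * ‖E x‖ ≤ ‖T (E x)‖ := by
    rw [← b.repr.norm_map, show ε * ‖E x‖ = ‖(ε : ℂ) • E x‖ by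
      rw [norm_smul, Complex.norm_real, Real.norm_of_nonneg hε]]
    refine lp.norm_mono two_ne_zero fun k => ?_
    rw [hT, lp.coeFn_smul, Pi.smul_apply, smul_eq_mul, norm_mul, norm_mul, Complex.norm_real,
      Real.norm_of_nonneg hε]
    by_cases hk : k ∈ S
    · gcongr
      exact h k hk
    · simp [hE, hk]
  have hup : ‖T (E x)‖ ≤ ‖T - A‖ * ‖E x‖ := by
    simpa [hx] using (T - A).le_opNorm (E x)
  exact le_of_mul_le_mul_right (hlow.trans hup) (norm_pos_iff.mpr hEx)

end ApproximationNumbers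

section Counting

/-- The univariate weight `(1+|k|^r)^{1/r}`. -/
def uWeight (r : ℝ) (k : ℤ) : ℝ := (1 + |(k : ℝ)| ^ r) ^ (1 / r)

variable {r : ℝ}

theorem one_le_uWeight (hr : 0 < r) (k : ℤ) : 1 ≤ uWeight r k :=
  Real.one_le_rpow (by have := Real.rpow_nonneg (abs_nonneg (k : ℝ)) r; linarith) (by positivity)

theorem uWeight_pos (hr : 0 < r) (k : ℤ) : 0 < uWeight r k :=
  zero_lt_one.trans_le (one_le_uWeight hr k)

theorem abs_le_uWeight (hr : 0 < r) (k : ℤ) : |(k : ℝ)| ≤ uWeight r k := by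
  have h0 := Real.rpow_nonneg (abs_nonneg (k : ℝ)) r
  calc |(k : ℝ)| = (|(k : ℝ)| ^ r) ^ (1 / r) := by
        rw [← Real.rpow_mul (abs_nonneg _), mul_one_div_cancel hr.ne', Real.rpow_one]
    _ ≤ uWeight r k := Real.rpow_le_rpow h0 (by linarith) (by positivity)

theorem uWeight_neg (k : ℤ) : uWeight r (-k) = uWeight r k := by
  simp [uWeight]

theorem uWeight_zero (hr : 0 < r) : uWeight r 0 = 1 := by
  simp [uWeight, Real.zero_rpow hr.ne']

theorem one_le_prod_uWeight (hr : 0 < r) {ι : Type*} (S : Finset ι) (k : ι → ℤ) :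
    1 ≤ ∏ j ∈ S, uWeight r (k j) := by
  simpa using Finset.prod_le_prod (s := S) (f := fun _ => (1 : ℝ)) (fun _ _ => zero_le_one)
    fun j _ => one_le_uWeight hr (k j)

/-- Asymptotically `(1+k^r)^{1/r}` is at most `k / q` for any `q < 1`. -/
theorem exists_uWeight_le (hr : 0 < r) {q : ℝ} (hq0 : 0 < q) (hq : q < 1) :
    ∃ K : ℕ, 1 ≤ K ∧ ∀ k : ℕ, K ≤ k → uWeight r k ≤ k / q := by
  have h1 : Tendsto (fun k : ℕ => (k : ℝ) ^ r) atTop atTop :=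
    (tendsto_rpow_atTop hr).comp tendsto_natCast_atTop_atTop
  have hqr : q ^ r < 1 := Real.rpow_lt_one hq0.le hq hr
  have hqr0 : 0 < q ^ r := Real.rpow_pos_of_pos hq0 r
  obtain ⟨K, hK⟩ := (h1.eventually_ge_atTop (q ^ r / (1 - q ^ r))).exists_forall_of_atTop
  refine ⟨max K 1, le_max_right _ _, fun k hk => ?_⟩
  have hk1 := hK k (le_trans (le_max_left _ _) hk)
  rw [div_le_iff₀ (by linarith)] at hk1
  have hk0 : (0 : ℝ) ≤ k / q := by positivity
  calc uWeight r k = (1 + (k : ℝ) ^ r) ^ (1 / r) := by simp [uWeight]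
    _ ≤ ((k / q) ^ r) ^ (1 / r) := by
        refine Real.rpow_le_rpow (by positivity) ?_ (by positivity)
        rw [Real.div_rpow (by positivity) hq0.le, le_div_iff₀ hqr0]
        linarith
    _ = k / q := by rw [← Real.rpow_mul hk0, mul_one_div_cancel hr.ne', Real.rpow_one]

/-- The lattice points of the hyperbolic cross `∏_j (1+|k_j|^r)^{1/r} ≤ R`. -/
def hypCross (r : ℝ) (d : ℕ) (R : ℝ) : Finset (ZLat d) :=
  open scoped Classical in
  (Fintype.piFinset fun _ => Finset.Icc (-(⌊R⌋₊ : ℤ)) ⌊R⌋₊).filter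
    fun k => ∏ j, uWeight r (k j) ≤ R

theorem mem_Icc_floor_of_abs_le {k : ℤ} {R : ℝ} (h : |(k : ℝ)| ≤ R) :
    k ∈ Finset.Icc (-(⌊R⌋₊ : ℤ)) ⌊R⌋₊ := by
  have h1 : k.natAbs ≤ ⌊R⌋₊ := Nat.le_floor (by rwa [Nat.cast_natAbs, Int.cast_abs])
  rw [Finset.mem_Icc]
  omega

theorem mem_hypCross (hr : 0 < r) {d : ℕ} {R : ℝ} {k : ZLat d} :
    k ∈ hypCross r d R ↔ ∏ j, uWeight r (k j) ≤ R := by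
  classical
  simp only [hypCross, Finset.mem_filter, Fintype.mem_piFinset, and_iff_right_iff_imp]
  intro h j
  refine mem_Icc_floor_of_abs_le ((abs_le_uWeight hr _).trans (le_trans ?_ h))
  rw [← Finset.mul_prod_erase _ _ (Finset.mem_univ j)]
  exact le_mul_of_one_le_right (uWeight_pos hr _).le
    (one_le_prod_uWeight hr _ _)

/-- The number of lattice points of a hyperbolic cross. -/
def hypCount (r : ℝ) (d : ℕ) (R : ℝ) : ℝ := (hypCross r d R).card

theorem hypCount_nonneg (d : ℕ) (R : ℝ) : 0 ≤ hypCount r d R := Nat.cast_nonneg _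

theorem hypCount_mono (hr : 0 < r) (d : ℕ) : Monotone (hypCount r d) := by
  intro R R' h
  refine Nat.cast_le.mpr (Finset.card_le_card fun k hk => ?_)
  rw [mem_hypCross hr] at hk ⊢
  exact hk.trans h

theorem hypCount_zero (hr : 0 < r) {R : ℝ} (hR : 1 ≤ R) : hypCount r 0 R = 1 := by
  have : hypCross r 0 R = Finset.univ := by
    ext k
    simpa [mem_hypCross hr, hR] using Subsingleton.elim _ _
  simp [hypCount, this]

theorem hypCount_succ (hr : 0 < r) (d : ℕ) (R : ℝ) :
    hypCount r (d + 1) R =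
      ∑ k ∈ Finset.Icc (-(⌊R⌋₊ : ℤ)) ⌊R⌋₊, hypCount r d (R / uWeight r k) := by
  classical
  have hmaps : ∀ x ∈ hypCross r (d + 1) R, x 0 ∈ Finset.Icc (-(⌊R⌋₊ : ℤ)) ⌊R⌋₊ := by
    intro x hx
    simp only [hypCross, Finset.mem_filter, Fintype.mem_piFinset] at hx
    exact hx.1 0
  rw [hypCount, Finset.card_eq_sum_card_fiberwise hmaps, Nat.cast_sum]
  refine Finset.sum_congr rfl fun k _ => ?_
  rw [hypCount, Nat.cast_inj]
  refine Finset.card_bij' (fun x _ => Fin.tail x) (fun y _ => Fin.cons k y) ?_ ?_ ?_ ?_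
  · intro x hx
    rw [Finset.mem_filter, mem_hypCross hr, Fin.prod_univ_succ] at hx
    rw [mem_hypCross hr, le_div_iff₀' (uWeight_pos hr k), ← hx.2]
    exact hx.1
  · intro y hy
    rw [mem_hypCross hr, le_div_iff₀' (uWeight_pos hr k)] at hy
    rw [Finset.mem_filter, mem_hypCross hr, Fin.prod_univ_succ]
    exact ⟨by simpa using hy, by simp⟩
  · intro x hx
    rw [← (Finset.mem_filter.mp hx).2]
    exact Fin.cons_self_tail x
  · intro y _
    exact Fin.tail_cons (α := fun _ => ℤ) k y

theorem hypCount_succ_eq (hr : 0 < r) (d : ℕ) (R : ℝ) :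
    hypCount r (d + 1) R = hypCount r d R +
      2 * ∑ k ∈ Finset.Ico 1 (⌊R⌋₊ + 1), hypCount r d (R / uWeight r k) := by
  have heven : (fun k : ℤ => hypCount r d (R / uWeight r k)).Even := by
    intro k
    simp only [uWeight_neg]
  rw [hypCount_succ hr, Finset.sum_Icc_of_even_eq_range heven, Finset.range_eq_Ico,
    Finset.sum_eq_sum_Ico_succ_bot (Nat.succ_pos _)]
  simp only [Nat.cast_zero, uWeight_zero hr, div_one, zero_add, two_smul]
  ring

theorem hypCount_succ_le (hr : 0 < r) (d : ℕ) (R : ℝ) (hR : 0 ≤ R) :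
    hypCount r (d + 1) R ≤ hypCount r d R +
      2 * ∑ k ∈ Finset.Ico 1 (⌊R⌋₊ + 1), hypCount r d (R / k) := by
  rw [hypCount_succ_eq hr]
  gcongr with k hk
  refine hypCount_mono hr d ?_
  have hk1 : (1 : ℝ) ≤ k := by exact_mod_cast (Finset.mem_Ico.mp hk).1
  have := abs_le_uWeight hr k
  rw [Int.cast_natCast, Nat.abs_cast] at this
  gcongr

theorem le_hypCount_succ (hr : 0 < r) (d : ℕ) {q : ℝ} (hq0 : 0 < q) (hq : q < 1) {K : ℕ}
    (hK1 : 1 ≤ K) (hK : ∀ k : ℕ, K ≤ k → uWeight r k ≤ k / q) (R : ℝ) (hR : 0 ≤ R) :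
    2 * ∑ k ∈ Finset.Ico K (⌊q * R⌋₊ + 1), hypCount r d (q * R / k) ≤ hypCount r (d + 1) R := by
  rw [hypCount_succ_eq hr]
  refine le_add_of_nonneg_of_le (hypCount_nonneg _ _) ?_
  gcongr
  have hsub : Finset.Ico K (⌊q * R⌋₊ + 1) ⊆ Finset.Ico 1 (⌊R⌋₊ + 1) := by
    refine Finset.Ico_subset_Ico hK1 ?_
    gcongr
    nlinarith
  refine (Finset.sum_le_sum fun k hk => ?_).trans
    (Finset.sum_le_sum_of_subset_of_nonneg hsub fun _ _ _ => hypCount_nonneg _ _)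
  refine hypCount_mono hr d ?_
  have hk := (Finset.mem_Ico.mp hk).1
  have hk1 : (1 : ℝ) ≤ k := by exact_mod_cast hK1.trans hk
  have h2 := hK k hk
  rw [le_div_iff₀ (uWeight_pos hr _)]
  calc q * R / k * uWeight r k ≤ q * R / k * (k / q) := by gcongr
    _ = R := by field_simp

end Counting

section LogSums

theorem pow_succ_add_mul_le {x y : ℝ} (hx : 0 ≤ x) (hy : 0 ≤ y) (m : ℕ) :
    y ^ (m + 1) + (m + 1) * y ^ m * (x - y) ≤ x ^ (m + 1) := by
  induction m with
  | zero => simp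
  | succ m ih =>
    have h1 := mul_le_mul_of_nonneg_left ih hx
    have h2 : 0 ≤ (m + 1) * y ^ m * (x - y) ^ 2 := by positivity
    push_cast
    calc _ = x * (y ^ (m + 1) + (m + 1) * y ^ m * (x - y)) - (m + 1) * y ^ m * (x - y) ^ 2 := by
          ring
      _ ≤ x ^ (m + 1 + 1) := by rw [pow_succ' x (m + 1)]; linarith

theorem pow_succ_div_add_mul_le {x y : ℝ} (hx : 0 ≤ x) (hy : 0 ≤ y) (m : ℕ) :
    y ^ (m + 1) / (m + 1) + y ^ m * (x - y) ≤ x ^ (m + 1) / (m + 1) := by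
  have hm : (0 : ℝ) < m + 1 := by positivity
  have := div_le_div_of_nonneg_right (pow_succ_add_mul_le hx hy m) hm.le
  rwa [add_div, mul_assoc, mul_div_cancel_left₀ _ hm.ne'] at this

theorem log_succ_sub_log_le {k : ℕ} (hk : 1 ≤ k) :
    Real.log (k + 1) - Real.log k ≤ 1 / k := by
  have hk0 : (0 : ℝ) < k := by exact_mod_cast hk
  rw [← Real.log_div (by positivity) hk0.ne']
  refine (Real.log_le_sub_one_of_pos (by positivity)).trans (le_of_eq ?_)
  field_simp
  ring

theorem le_log_succ_sub_log {k : ℕ} (hk : 1 ≤ k) :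
    1 / ((k : ℝ) + 1) ≤ Real.log (k + 1) - Real.log k := by
  have hk0 : (0 : ℝ) < k := by exact_mod_cast hk
  rw [← Real.log_div (by positivity) hk0.ne']
  refine le_trans (le_of_eq ?_) (Real.one_sub_inv_le_log_of_pos (by positivity))
  field_simp
  ring

theorem sum_inv_mul_log_pow_le (m : ℕ) {R : ℝ} {M : ℕ} (hM : 1 ≤ M) (hMR : (M : ℝ) ≤ R) :
    ∑ k ∈ Finset.Ico 1 (M + 1), 1 / (k : ℝ) * Real.log (R / k) ^ m ≤
      Real.log R ^ m + Real.log R ^ (m + 1) / (m + 1) - Real.log (R / M) ^ (m + 1) / (m + 1) := by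
  induction M, hM using Nat.le_induction with
  | base => simp
  | succ M hM ih =>
    have hM0 : (0 : ℝ) < M := by exact_mod_cast hM
    push_cast at hMR
    have hR : 0 < R := by linarith
    rw [Finset.sum_Ico_succ_top (by omega)]
    push_cast
    have ih := ih (by linarith)
    have hx : 0 ≤ Real.log (R / M) := Real.log_nonneg (by rw [one_le_div hM0]; linarith)
    have hy : 0 ≤ Real.log (R / (M + 1)) :=
      Real.log_nonneg (by rw [one_le_div (by positivity)]; linarith)
    have h1 := pow_succ_div_add_mul_le hx hy m
    have h2 : 1 / ((M : ℝ) + 1) ≤ Real.log (R / M) - Real.log (R / (M + 1)) := by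
      rw [Real.log_div hR.ne' hM0.ne', Real.log_div hR.ne' (by positivity)]
      linarith [le_log_succ_sub_log hM]
    have h3 := mul_le_mul_of_nonneg_left h2 (pow_nonneg hy m)
    linarith

theorem le_sum_inv_mul_log_pow (m : ℕ) {R : ℝ} {K : ℕ} (hK : 1 ≤ K) (hKR : (K : ℝ) ≤ R) :
    Real.log (R / K) ^ (m + 1) / (m + 1) ≤
      ∑ k ∈ Finset.Ico K (⌊R⌋₊ + 1), 1 / (k : ℝ) * Real.log (R / k) ^ m := by
  have hK0 : (0 : ℝ) < K := by exact_mod_cast hK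
  have hR : 0 < R := by linarith
  have step : ∀ k : ℕ, K ≤ k → (k : ℝ) ≤ R → ∀ y, 0 ≤ y →
      Real.log (R / (k + 1)) ≤ y →
      Real.log (R / k) ^ (m + 1) / (m + 1) - y ^ (m + 1) / (m + 1) ≤
        1 / (k : ℝ) * Real.log (R / k) ^ m := by
    intro k hk hkR y hy hylog
    have hk0 : (0 : ℝ) < k := by exact_mod_cast hK.trans hk
    have hx : 0 ≤ Real.log (R / k) := Real.log_nonneg (by rwa [one_le_div hk0])
    have h1 := pow_succ_div_add_mul_le hy hx m
    have h2 : Real.log (R / k) - y ≤ 1 / k := by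
      rw [Real.log_div hR.ne' hk0.ne']
      rw [Real.log_div hR.ne' (by positivity)] at hylog
      linarith [log_succ_sub_log_le (hK.trans hk)]
    have h3 := mul_le_mul_of_nonneg_left h2 (pow_nonneg hx m)
    linarith
  have main : ∀ N : ℕ, K ≤ N → (N : ℝ) ≤ R →
      Real.log (R / K) ^ (m + 1) / (m + 1) - Real.log (R / N) ^ (m + 1) / (m + 1) ≤
        ∑ k ∈ Finset.Ico K N, 1 / (k : ℝ) * Real.log (R / k) ^ m := by
    intro N hN
    induction N, hN using Nat.le_induction with
    | base => simp
    | succ N hN ih =>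
      intro hNR
      push_cast at hNR
      rw [Finset.sum_Ico_succ_top hN]
      push_cast
      have hy : 0 ≤ Real.log (R / (N + 1)) :=
        Real.log_nonneg (by rw [one_le_div (by positivity)]; linarith)
      linarith [ih (by linarith), step N hN (by linarith) _ hy le_rfl]
  have hKM : K ≤ ⌊R⌋₊ := Nat.le_floor hKR
  have hMR : (⌊R⌋₊ : ℝ) ≤ R := Nat.floor_le hR.le
  rw [Finset.sum_Ico_succ_top hKM]
  have hlast : Real.log (R / (⌊R⌋₊ + 1)) ≤ 0 := by
    refine Real.log_nonpos (by positivity) ?_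
    rw [div_le_one (by positivity)]
    exact (Nat.lt_floor_add_one R).le
  have := step _ hKM hMR 0 le_rfl hlast
  rw [zero_pow (Nat.succ_ne_zero m), zero_div, sub_zero] at this
  linarith [main _ hKM hMR]

end LogSums

section Growth

/-- An asymptotic `F(R) ~ C R (log R)^m` of a monotone function gives an upper bound valid
on all of `[1,∞)`. -/
theorem exists_forall_le_of_tendsto {F : ℝ → ℝ} (hF : Monotone F) (hF0 : ∀ x, 0 ≤ F x) {m : ℕ}
    {C c : ℝ} (h : Tendsto (fun R => F R / (R * Real.log R ^ m)) atTop (nhds C)) (hc : C < c)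
    (hc0 : 0 ≤ c) :
    ∃ B, 0 ≤ B ∧ ∀ x, 1 ≤ x → F x ≤ c * (x * Real.log x ^ m) + B := by
  obtain ⟨R₀, hR₀⟩ := ((h.eventually_lt_const hc).and
    (eventually_gt_atTop (1 : ℝ))).exists_forall_of_atTop
  refine ⟨F R₀, hF0 _, fun x hx => ?_⟩
  rcases le_total R₀ x with hxR | hxR
  · obtain ⟨h1, h2⟩ := hR₀ x hxR
    have : 0 < x * Real.log x ^ m := mul_pos (by linarith) (pow_pos (Real.log_pos h2) m)
    rw [div_lt_iff₀ this] at h1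
    linarith [hF0 R₀]
  · have : 0 ≤ c * (x * Real.log x ^ m) :=
      mul_nonneg hc0 (mul_nonneg (by linarith) (pow_nonneg (Real.log_nonneg hx) m))
    linarith [hF hxR]

/-- An asymptotic `F(R) ~ C R (log R)^m` gives a lower bound valid on all of `[1,∞)`. -/
theorem exists_forall_ge_of_tendsto {F : ℝ → ℝ} (hF0 : ∀ x, 0 ≤ F x) {m : ℕ}
    {C c : ℝ} (h : Tendsto (fun R => F R / (R * Real.log R ^ m)) atTop (nhds C)) (hc : c < C)
    (hc0 : 0 ≤ c) :
    ∃ B, 0 ≤ B ∧ ∀ x, 1 ≤ x → c * (x * Real.log x ^ m) - B ≤ F x := by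
  obtain ⟨R₀, hR₀⟩ := ((h.eventually_const_lt hc).and
    (eventually_gt_atTop (1 : ℝ))).exists_forall_of_atTop
  have h0 : 0 ≤ R₀ := by linarith [(hR₀ R₀ le_rfl).2]
  have h0' : 0 ≤ Real.log R₀ := Real.log_nonneg (hR₀ R₀ le_rfl).2.le
  refine ⟨c * (R₀ * Real.log R₀ ^ m), by positivity, fun x hx => ?_⟩
  have hl := Real.log_nonneg hx
  rcases le_total R₀ x with hxR | hxR
  · obtain ⟨h1, h2⟩ := hR₀ x hxR
    have : 0 < x * Real.log x ^ m := mul_pos (by linarith) (pow_pos (Real.log_pos h2) m)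
    rw [lt_div_iff₀ this] at h1
    have : 0 ≤ c * (R₀ * Real.log R₀ ^ m) := by positivity
    linarith
  · have : c * (x * Real.log x ^ m) ≤ c * (R₀ * Real.log R₀ ^ m) := by
      gcongr
    linarith [hF0 x]

variable {r : ℝ}

theorem tendsto_hypCount_one (hr : 0 < r) :
    Tendsto (fun R => hypCount r 1 R / R) atTop (nhds 2) := by
  rw [tendsto_order]
  constructor
  · intro a ha
    obtain ⟨q, hq1, hq2⟩ := exists_between (max_lt (show a / 2 < 1 by linarith) zero_lt_one)
    obtain ⟨haq, hq0⟩ := max_lt_iff.mp hq1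
    obtain ⟨K, hK1, hK⟩ := exists_uWeight_le hr hq0 hq2
    filter_upwards [eventually_gt_atTop (2 * K / (2 * q - a)),
      eventually_gt_atTop 0] with R hR hR0
    rw [lt_div_iff₀ hR0]
    rw [div_lt_iff₀ (by linarith)] at hR
    refine lt_of_lt_of_le ?_ (le_hypCount_succ hr 0 hq0 hq2 hK1 hK R hR0.le)
    have hsum : ∑ k ∈ Finset.Ico K (⌊q * R⌋₊ + 1), hypCount r 0 (q * R / k) =
        ∑ k ∈ Finset.Ico K (⌊q * R⌋₊ + 1), (1 : ℝ) := by
      refine Finset.sum_congr rfl fun k hk => ?_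
      obtain ⟨hk1, hk2⟩ := Finset.mem_Ico.mp hk
      have hk0 : (0 : ℝ) < k := by exact_mod_cast hK1.trans hk1
      refine hypCount_zero hr ?_
      rw [one_le_div hk0]
      exact (Nat.le_floor_iff (by positivity)).mp (Nat.lt_succ_iff.mp hk2)
    rw [hsum, Finset.sum_const, Nat.card_Ico, nsmul_eq_mul, mul_one]
    have h1 : (⌊q * R⌋₊ + 1 : ℕ) ≤ (⌊q * R⌋₊ + 1 - K) + K := by omega
    have h2 : ((⌊q * R⌋₊ + 1 : ℕ) : ℝ) ≤ ((⌊q * R⌋₊ + 1 - K : ℕ) : ℝ) + K := by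
      exact_mod_cast h1
    have h3 := Nat.lt_floor_add_one (q * R)
    push_cast at h2
    linarith
  · intro a ha
    filter_upwards [eventually_gt_atTop (1 / (a - 2)), eventually_ge_atTop 1] with R hR hR1
    have hR0 : 0 < R := by linarith
    rw [div_lt_iff₀ hR0]
    rw [div_lt_iff₀ (by linarith)] at hR
    refine (hypCount_succ_le hr 0 R hR0.le).trans_lt ?_
    have hsum : ∑ k ∈ Finset.Ico 1 (⌊R⌋₊ + 1), hypCount r 0 (R / k) =
        ∑ k ∈ Finset.Ico 1 (⌊R⌋₊ + 1), (1 : ℝ) := by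
      refine Finset.sum_congr rfl fun k hk => ?_
      obtain ⟨hk1, hk2⟩ := Finset.mem_Ico.mp hk
      have hk0 : (0 : ℝ) < k := by exact_mod_cast hk1
      refine hypCount_zero hr ?_
      rw [one_le_div hk0]
      exact (Nat.le_floor_iff hR0.le).mp (Nat.lt_succ_iff.mp hk2)
    rw [hsum, Finset.sum_const, Nat.card_Ico, nsmul_eq_mul, mul_one, hypCount_zero hr hR1]
    have h3 := Nat.floor_le hR0.le
    rw [Nat.add_sub_cancel]
    linarith

theorem tendsto_hypCount_succ (hr : 0 < r) {d m : ℕ} {C : ℝ} (hC : 0 < C)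
    (h : Tendsto (fun R => hypCount r d R / (R * Real.log R ^ m)) atTop (nhds C)) :
    Tendsto (fun R => hypCount r (d + 1) R / (R * Real.log R ^ (m + 1))) atTop
      (nhds (2 * C / (m + 1))) := by
  have hinv : Tendsto (fun R => (Real.log R)⁻¹) atTop (nhds 0) :=
    Real.tendsto_log_atTop.inv_tendsto_atTop
  have hinvm : Tendsto (fun R => (Real.log R)⁻¹ ^ (m + 1)) atTop (nhds 0) := by
    simpa using hinv.pow (m + 1)
  have hm : (0 : ℝ) < m + 1 := by positivity
  rw [tendsto_order]
  constructor
  · intro a ha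
    have hcont : Tendsto (fun q : ℝ => 2 * (q * C) * q / (m + 1)) (nhdsWithin 1 (Set.Iio 1))
        (nhds (2 * C / (m + 1))) := by
      refine tendsto_nhdsWithin_of_tendsto_nhds ?_
      have : ContinuousAt (fun q : ℝ => 2 * (q * C) * q / (m + 1)) 1 := by fun_prop
      simpa [ContinuousAt] using this
    obtain ⟨q, hqa, hq1, hq0⟩ := ((hcont.eventually_const_lt ha).and
      (eventually_mem_nhdsWithin.and
        (tendsto_nhdsWithin_of_tendsto_nhds tendsto_id |>.eventually_const_lt
          (zero_lt_one (α := ℝ))))).exists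
    simp only [Set.mem_Iio, id] at hq1 hq0
    obtain ⟨K, hK1, hK⟩ := exists_uWeight_le hr hq0 hq1
    have hK0 : (0 : ℝ) < K := by exact_mod_cast hK1
    obtain ⟨B, hB0, hB⟩ := exists_forall_ge_of_tendsto (hypCount_nonneg (r := r) d) h
      (show q * C < C by nlinarith) (by positivity)
    have hlim : Tendsto (fun R => 2 * (q * C) * q / (m + 1) *
        (1 + Real.log (q / K) * (Real.log R)⁻¹) ^ (m + 1)
          - 2 * B * q * (Real.log R)⁻¹ ^ (m + 1)) atTop
        (nhds (2 * (q * C) * q / (m + 1))) := by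
      have := (((hinv.const_mul (Real.log (q / K))).const_add 1).pow (m + 1)).const_mul
        (2 * (q * C) * q / (m + 1)) |>.sub (hinvm.const_mul (2 * B * q))
      simpa using this
    filter_upwards [hlim.eventually_const_lt hqa, eventually_ge_atTop (K / q),
      eventually_gt_atTop 1] with R hR hRK hR1
    have hR0 : 0 < R := by linarith
    have hL : 0 < Real.log R := Real.log_pos hR1
    rw [div_le_iff₀ hq0, mul_comm] at hRK
    refine hR.trans_le ?_
    rw [le_div_iff₀ (by positivity)]
    refine le_trans ?_ (le_hypCount_succ hr d hq0 hq1 hK1 hK R hR0.le)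
    have hlog : Real.log (q * R / K) = Real.log R + Real.log (q / K) := by
      rw [← Real.log_mul (by positivity) (by positivity)]
      congr 1
      ring
    have hsum : q * C * (q * R) * (Real.log (q * R / K) ^ (m + 1) / (m + 1)) - B * (q * R) ≤
        ∑ k ∈ Finset.Ico K (⌊q * R⌋₊ + 1), hypCount r d (q * R / k) := by
      have h1 : ∀ k ∈ Finset.Ico K (⌊q * R⌋₊ + 1),
          q * C * (q * R) * (1 / (k : ℝ) * Real.log (q * R / k) ^ m) - B ≤
            hypCount r d (q * R / k) := by
        intro k hk
        obtain ⟨hk1, hk2⟩ := Finset.mem_Ico.mp hk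
        have hk0 : (0 : ℝ) < k := by exact_mod_cast hK1.trans hk1
        refine le_trans (le_of_eq ?_) (hB (q * R / k) ?_)
        · ring
        · rw [one_le_div hk0]
          exact (Nat.le_floor_iff (by positivity)).mp (Nat.lt_succ_iff.mp hk2)
      refine le_trans ?_ (Finset.sum_le_sum h1)
      rw [Finset.sum_sub_distrib, ← Finset.mul_sum, Finset.sum_const, Nat.card_Ico, nsmul_eq_mul,
        mul_comm _ B]
      have h2 : ((⌊q * R⌋₊ + 1 - K : ℕ) : ℝ) ≤ q * R := by
        refine le_trans ?_ (Nat.floor_le (by positivity : 0 ≤ q * R))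
        exact_mod_cast (by omega : ⌊q * R⌋₊ + 1 - K ≤ ⌊q * R⌋₊)
      have h3 := le_sum_inv_mul_log_pow m hK1 hRK
      gcongr
    refine le_trans (le_of_eq ?_) (mul_le_mul_of_nonneg_left hsum zero_le_two)
    rw [hlog, show Real.log R + Real.log (q / K) =
      Real.log R * (1 + Real.log (q / K) * (Real.log R)⁻¹) by field_simp, mul_pow, inv_pow]
    generalize (1 + Real.log (q / K) * (Real.log R)⁻¹) ^ (m + 1) = X
    field_simp
  · intro a ha
    have hcont : Tendsto (fun q : ℝ => 2 * (q * C) / (m + 1)) (nhdsWithin 1 (Set.Ioi 1))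
        (nhds (2 * C / (m + 1))) := by
      refine tendsto_nhdsWithin_of_tendsto_nhds ?_
      have : ContinuousAt (fun q : ℝ => 2 * (q * C) / (m + 1)) 1 := by fun_prop
      simpa [ContinuousAt] using this
    obtain ⟨q, hqa, hq1⟩ := ((hcont.eventually_lt_const ha).and
      eventually_mem_nhdsWithin).exists
    simp only [Set.mem_Ioi] at hq1
    have hq0 : 0 < q := by linarith
    obtain ⟨B, hB0, hB⟩ := exists_forall_le_of_tendsto (hypCount_mono hr d)
      (hypCount_nonneg (r := r) d) h (show C < q * C by nlinarith) (by positivity)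
    have hlim : Tendsto (fun R => 2 * (q * C) / (m + 1) + 3 * (q * C) * (Real.log R)⁻¹
          + 3 * B * (Real.log R)⁻¹ ^ (m + 1)) atTop
        (nhds (2 * (q * C) / (m + 1))) := by
      have := ((hinv.const_mul (3 * (q * C))).const_add (2 * (q * C) / (m + 1))).add
        (hinvm.const_mul (3 * B))
      simpa using this
    filter_upwards [hlim.eventually_lt_const hqa, eventually_gt_atTop 1] with R hR hR1
    have hR0 : 0 < R := by linarith
    have hL : 0 < Real.log R := Real.log_pos hR1
    refine lt_of_le_of_lt ?_ hR
    rw [div_le_iff₀ (by positivity)]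
    refine (hypCount_succ_le hr d R hR0.le).trans ?_
    have hM : 1 ≤ ⌊R⌋₊ := Nat.le_floor (by exact_mod_cast hR1.le)
    have hMR := Nat.floor_le hR0.le
    have hM0 : (0 : ℝ) < ⌊R⌋₊ := by exact_mod_cast hM
    have hsum : ∑ k ∈ Finset.Ico 1 (⌊R⌋₊ + 1), hypCount r d (R / k) ≤
        q * C * R * (Real.log R ^ m + Real.log R ^ (m + 1) / (m + 1)) + B * R := by
      have h1 : ∀ k ∈ Finset.Ico 1 (⌊R⌋₊ + 1), hypCount r d (R / k) ≤
          q * C * R * (1 / (k : ℝ) * Real.log (R / k) ^ m) + B := by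
        intro k hk
        obtain ⟨hk1, hk2⟩ := Finset.mem_Ico.mp hk
        have hk0 : (0 : ℝ) < k := by exact_mod_cast hk1
        refine le_trans (hB (R / k) ?_) (le_of_eq ?_)
        · rw [one_le_div hk0]
          exact (Nat.le_floor_iff hR0.le).mp (Nat.lt_succ_iff.mp hk2)
        · ring
      refine (Finset.sum_le_sum h1).trans ?_
      rw [Finset.sum_add_distrib, ← Finset.mul_sum, Finset.sum_const, Nat.card_Ico, nsmul_eq_mul,
        mul_comm _ B, Nat.add_sub_cancel]
      have h3 := sum_inv_mul_log_pow_le m hM hMR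
      have h4 : 0 ≤ Real.log (R / ⌊R⌋₊) ^ (m + 1) / (m + 1) := by
        have : 0 ≤ Real.log (R / ⌊R⌋₊) := Real.log_nonneg (by rwa [one_le_div hM0])
        positivity
      gcongr
      linarith
    have hFR := hB R hR1.le
    have hBR : B ≤ B * R := le_mul_of_one_le_right hB0 hR1.le
    calc _ ≤ q * C * (R * Real.log R ^ m) + B * R +
          2 * (q * C * R * (Real.log R ^ m + Real.log R ^ (m + 1) / (m + 1)) + B * R) := by
          linarith
      _ = _ := by
          rw [inv_pow]
          field_simp
          ring

theorem tendsto_hypCount (hr : 0 < r) (m : ℕ) :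
    Tendsto (fun R => hypCount r (m + 1) R / (R * Real.log R ^ m)) atTop
      (nhds (2 ^ (m + 1) / (m.factorial : ℝ))) := by
  induction m with
  | zero => simpa using tendsto_hypCount_one hr
  | succ m ih =>
    convert tendsto_hypCount_succ hr (by positivity) ih using 2
    rw [Nat.factorial_succ]
    push_cast
    field_simp
    ring

end Growth

section Inversion

/-- The radius at which the counting function is about `x`, up to a constant. -/
theorem tendsto_div_log_pow_atTop {B : ℝ} (hB : 0 < B) (m : ℕ) :
    Tendsto (fun x : ℝ => x / (B * Real.log x ^ m)) atTop atTop := by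
  have h1 : Tendsto (fun x : ℝ => B * Real.log x ^ m / x) atTop (nhdsWithin 0 (Set.Ioi 0)) := by
    rw [tendsto_nhdsWithin_iff]
    constructor
    · have := ((Real.isLittleO_pow_log_id_atTop (n := m)).tendsto_div_nhds_zero).const_mul B
      simpa [mul_div_assoc] using this
    · filter_upwards [eventually_gt_atTop 1] with x hx
      have := Real.log_pos hx
      exact Set.mem_Ioi.mpr (by positivity)
  refine h1.inv_tendsto_nhdsGT_zero.congr fun x => ?_
  rw [Pi.inv_apply, inv_div]

theorem tendsto_log_div_log {B : ℝ} (hB : 0 < B) (m : ℕ) :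
    Tendsto (fun x : ℝ => Real.log (x / (B * Real.log x ^ m)) / Real.log x) atTop (nhds 1) := by
  have h1 : Tendsto (fun x : ℝ => Real.log (Real.log x) / Real.log x) atTop (nhds 0) :=
    (Real.isLittleO_log_id_atTop.tendsto_div_nhds_zero).comp Real.tendsto_log_atTop
  have h2 : Tendsto (fun x : ℝ => Real.log B / Real.log x) atTop (nhds 0) :=
    Real.tendsto_log_atTop.const_div_atTop _
  have h3 : Tendsto (fun x : ℝ => 1 - (Real.log B / Real.log x +
      m * (Real.log (Real.log x) / Real.log x))) atTop (nhds 1) := by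
    simpa using (h2.add (h1.const_mul (m : ℝ))).const_sub 1
  refine h3.congr' ?_
  filter_upwards [eventually_gt_atTop 1] with x hx
  have hL := Real.log_pos hx
  rw [Real.log_div (by positivity) (by positivity), Real.log_mul hB.ne' (by positivity),
    Real.log_pow]
  field_simp

theorem tendsto_comp_div_log_pow {N : ℝ → ℝ} {C : ℝ} {m : ℕ}
    (hN : Tendsto (fun R => N R / (R * Real.log R ^ m)) atTop (nhds C)) {B : ℝ} (hB : 0 < B) :
    Tendsto (fun n : ℕ => N (n / (B * Real.log n ^ m)) / n) atTop (nhds (C / B)) := by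
  have h1 := hN.comp (tendsto_div_log_pow_atTop hB m)
  have h2 : Tendsto (fun x : ℝ => N (x / (B * Real.log x ^ m)) / x) atTop (nhds (C / B)) := by
    have h3 := (h1.mul ((tendsto_log_div_log hB m).pow m)).div_const B
    rw [one_pow, mul_one] at h3
    refine h3.congr' ?_
    filter_upwards [eventually_gt_atTop 1,
      (tendsto_div_log_pow_atTop hB m).eventually_gt_atTop 1] with x hx hR
    have hL := Real.log_pos hx
    have hLR := Real.log_pos hR
    simp only [Function.comp_apply]
    generalize N (x / (B * Real.log x ^ m)) = y
    generalize Real.log (x / (B * Real.log x ^ m)) = z at hLR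
    rw [div_pow]
    field_simp
  exact h2.comp tendsto_natCast_atTop_atTop

end Inversion

section Main

theorem wMix_eq_prod_uWeight_rpow {r : ℝ} (hr : 0 < r) (d : ℕ) (s : ℝ) (k : ZLat d) :
    wMix d s r k = (∏ j, uWeight r (k j)) ^ s := by
  rw [wMix, ← Real.finsetProd_rpow _ _ fun j _ => (uWeight_pos hr (k j)).le]
  refine Finset.prod_congr rfl fun j _ => ?_
  rw [uWeight, ← Real.rpow_mul
    (by have := Real.rpow_nonneg (abs_nonneg (k j : ℝ)) r; linarith), one_div_mul_eq_div]

theorem rpow_mul_rpow_neg_div {x y B s : ℝ} (hx : 0 < x) (hy : 0 < y) (hB : 0 < B) (m : ℕ) :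
    x ^ s * (x / (B * y ^ m)) ^ (-s) / y ^ (m * s) = B ^ s := by
  rw [Real.rpow_neg (by positivity), Real.div_rpow hx.le (by positivity),
    Real.mul_rpow hB.le (by positivity), Real.rpow_mul hy.le, Real.rpow_natCast]
  have h1 : 0 < x ^ s := Real.rpow_pos_of_pos hx s
  have h2 : 0 < (y ^ m) ^ s := Real.rpow_pos_of_pos (by positivity) s
  have h3 : 0 < B ^ s := Real.rpow_pos_of_pos hB s
  field_simp

end Main

/-- formula (9) of Cobos–Kühn–Sickel. For `d ∈ ℕ`, `s > 0` and
`0 < r < ∞`,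
`lim_{n→∞} n^s a_n(I_d : H^{s,r}_mix(𝕋^d) → L₂(𝕋^d)) / (ln n)^{(d-1)s}
  = (2^d/(d-1)!)^s`. -/
theorem statement9 (d : ℕ) (hd : 0 < d) (s r : ℝ) (hs : 0 < s) (hr : 0 < r)
    (T : ellTwo d →L[ℂ] Lp ℂ 2 (torusMeasure d))
    (hT : ∀ (c : ellTwo d) (k : ZLat d), fourierCoef (⇑(T c)) k = c k / (wMix d s r k : ℂ)) :
    Tendsto
      (fun n : ℕ => (n : ℝ) ^ s * approxNum T n / Real.log n ^ (((d : ℝ) - 1) * s))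
      atTop (nhds (((2 : ℝ) ^ d / (Nat.factorial (d - 1) : ℝ)) ^ s)) := by
  obtain ⟨m, rfl⟩ : ∃ m, d = m + 1 := ⟨d - 1, by omega⟩
  have hrepr : ∀ (c : ellTwo (m + 1)) (k : ZLat (m + 1)),
      (torusBasis (m + 1)).repr (T c) k = (wMix (m + 1) s r k : ℂ)⁻¹ * c k := by
    intro c k
    rw [torusBasis_repr, hT, div_eq_inv_mul]
  have hprod : ∀ k : ZLat (m + 1), 0 < ∏ j, uWeight r (k j) := fun k =>
    Finset.prod_pos fun j _ => uWeight_pos hr (k j)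
  have hnorm : ∀ k : ZLat (m + 1),
      ‖(wMix (m + 1) s r k : ℂ)⁻¹‖ = (∏ j, uWeight r (k j)) ^ (-s) := by
    intro k
    rw [wMix_eq_prod_uWeight_rpow hr, norm_inv, Complex.norm_real,
      Real.norm_of_nonneg (Real.rpow_nonneg (hprod k).le s), Real.rpow_neg (hprod k).le]
  have hupper : ∀ (n : ℕ) (R : ℝ), 0 < R → hypCount r (m + 1) R < n →
      approxNum T n ≤ R ^ (-s) := by
    intro n R hR hn
    refine approxNum_le_of_diagonal (torusBasis (m + 1)) T _ hrepr (Real.rpow_nonneg hR.le _)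
      (hypCross r (m + 1) R) (Nat.cast_lt.mp hn) fun k hk => ?_
    rw [mem_hypCross hr, not_le] at hk
    rw [hnorm]
    exact Real.rpow_le_rpow_of_nonpos hR hk.le (by linarith)
  have hlower : ∀ (n : ℕ) (R : ℝ), 0 < n → 0 < R → (n : ℝ) ≤ hypCount r (m + 1) R →
      R ^ (-s) ≤ approxNum T n := by
    intro n R hn0 hR hn
    refine le_approxNum_of_diagonal (torusBasis (m + 1)) T _ hrepr hn0 (Real.rpow_nonneg hR.le _)
      (hypCross r (m + 1) R) (Nat.cast_le.mp hn) fun k hk => ?_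
    rw [mem_hypCross hr] at hk
    rw [hnorm]
    exact Real.rpow_le_rpow_of_nonpos (hprod k) hk (by linarith)
  rw [Nat.add_sub_cancel, show (((m + 1 : ℕ) : ℝ) - 1) * s = m * s by push_cast; ring]
  set C : ℝ := 2 ^ (m + 1) / (m.factorial : ℝ) with hCdef
  have hC : 0 < C := by positivity
  have hN := tendsto_hypCount hr m
  have hcont : ContinuousAt (fun B : ℝ => B ^ s) C :=
    Real.continuousAt_rpow_const _ _ (Or.inl hC.ne')
  rw [tendsto_order]
  constructor
  · intro a ha
    obtain ⟨B, haB, hBC, hB0⟩ :=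
      ((tendsto_nhdsWithin_of_tendsto_nhds hcont |>.eventually_const_lt ha).and
      (eventually_mem_nhdsWithin.and
        (tendsto_nhdsWithin_of_tendsto_nhds tendsto_id |>.eventually_const_lt hC)) :
        ∀ᶠ B in nhdsWithin C (Set.Iio C), _).exists
    simp only [Set.mem_Iio, id] at hBC hB0
    filter_upwards [(tendsto_comp_div_log_pow hN hB0).eventually_const_lt ((one_lt_div hB0).mpr hBC),
      eventually_gt_atTop 1] with n hn hn1
    have hx : (1 : ℝ) < n := by exact_mod_cast hn1
    have hx0 : (0 : ℝ) < n := by linarith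
    have hL := Real.log_pos hx
    rw [one_lt_div hx0] at hn
    have := hlower n _ (by omega) (by positivity) hn.le
    refine haB.trans_le ?_
    rw [← rpow_mul_rpow_neg_div hx0 hL hB0 m]
    gcongr
  · intro a ha
    obtain ⟨B, haB, hBC⟩ :=
      ((tendsto_nhdsWithin_of_tendsto_nhds hcont |>.eventually_lt_const ha).and
      eventually_mem_nhdsWithin : ∀ᶠ B in nhdsWithin C (Set.Ioi C), _).exists
    simp only [Set.mem_Ioi] at hBC
    have hB0 : 0 < B := hC.trans hBC
    filter_upwards [(tendsto_comp_div_log_pow hN hB0).eventually_lt_const ((div_lt_one hB0).mpr hBC),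
      eventually_gt_atTop 1] with n hn hn1
    have hx : (1 : ℝ) < n := by exact_mod_cast hn1
    have hx0 : (0 : ℝ) < n := by linarith
    have hL := Real.log_pos hx
    rw [div_lt_one hx0] at hn
    have := hupper n _ (by positivity) hn
    refine lt_of_le_of_lt ?_ haB
    rw [← rpow_mul_rpow_neg_div hx0 hL hB0 m]
    gcongr
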